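/- arXiv:2209.08833 — 5 statements merged into one kernel-verified Lean document; each statement's English description precedes it below -/
import Mathlib

section
/- Let c > 0 and define Q_c(x) := √(2c)·sech(√c·x). Then Q_c satisfies the fourth-order elliptic equation Q_c''''(x) − 2c·(Q_c''(x) + Q_c(x)³) + c²·Q_c(x) + 5·Q_c(x)·(Q_c'(x))² + 5·Q_c(x)²·Q_c''(x) + (3/2)·Q_c(x)⁵ = 0 for every x ∈ ℝ. (This is the Euler–Lagrange equation of the functional F + 2c·E + c²·M at the soliton.) -/
/-- For `c > 0` and `Q_c(x) := √(2c)·sech(√c·x)`, the fourth-order elliptic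
equation `Q'''' − 2c(Q'' + Q³) + c²Q + 5Q(Q')² + 5Q²Q'' + (3/2)Q⁵ = 0` holds pointwise. -/
theorem soliton_fourth_order_equation (c : ℝ) (hc : 0 < c) (Q : ℝ → ℝ)
    (hQ : ∀ x : ℝ, Q x = Real.sqrt (2 * c) * (Real.cosh (Real.sqrt c * x))⁻¹) :
    ∀ x : ℝ,
      iteratedDeriv 4 Q x - 2 * c * (deriv (deriv Q) x + (Q x) ^ 3) + c ^ 2 * Q x
        + 5 * Q x * (deriv Q x) ^ 2 + 5 * (Q x) ^ 2 * deriv (deriv Q) x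
        + (3 / 2) * (Q x) ^ 5 = 0 := by
  obtain ⟨a, ha⟩ : ∃ a, a = Real.sqrt c := ⟨_, rfl⟩
  obtain ⟨b, hb⟩ : ∃ b, b = Real.sqrt (2 * c) := ⟨_, rfl⟩
  have ha2 : a ^ 2 = c := by rw [ha]; exact Real.sq_sqrt hc.le
  have hb2 : b ^ 2 = 2 * c := by rw [hb]; exact Real.sq_sqrt (by positivity)
  rw [← ha, ← hb] at hQ
  have hQf : Q = fun x => b * (Real.cosh (a * x))⁻¹ := funext hQ
  obtain ⟨P, hP⟩ : ∃ P : ℝ → ℝ, P = fun x =>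
      b * (-(Real.sinh (a * x) * a) / (Real.cosh (a * x)) ^ 2) := ⟨_, rfl⟩
  have hl : ∀ x : ℝ, HasDerivAt (fun y : ℝ => a * y) a x := fun x => by
    simpa using (hasDerivAt_id x).const_mul a
  have hC : ∀ x : ℝ, Real.cosh (a * x) ≠ 0 := fun x => (Real.cosh_pos _).ne'
  have hS : ∀ x : ℝ, Real.sinh (a * x) ^ 2 = Real.cosh (a * x) ^ 2 - 1 := fun x =>
    Real.sinh_sq _
  have d1 : ∀ x, HasDerivAt Q (P x) x := fun x => by
    rw [hQf, hP]
    exact ((hl x).cosh.inv (hC x)).const_mul b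
  have hPsq : ∀ x, P x ^ 2 = c * Q x ^ 2 - Q x ^ 4 / 2 := fun x => by
    have e4 : b ^ 4 = 4 * c ^ 2 := by
      rw [show b ^ 4 = (b ^ 2) ^ 2 by ring, hb2]; ring
    have h0 := hC x
    have h1 := hS x
    rw [hP, hQ x]
    simp only [mul_pow, div_pow, neg_sq, inv_pow]
    rw [h1, hb2, ha2, e4]
    field_simp
    ring
  have d2 : ∀ x, HasDerivAt P (c * Q x - Q x ^ 3) x := fun x => by
    have h0 := hC x
    have h1 := hS x
    have key := ((((hl x).sinh.mul_const a).neg).div ((hl x).cosh.pow 2)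
      (pow_ne_zero 2 h0)).const_mul b
    rw [hP]
    refine key.congr_deriv ?_
    have e3 : b ^ 3 = 2 * c * b := by
      rw [show b ^ 3 = b ^ 2 * b by ring, hb2]
    rw [hQ x, mul_pow, e3, ← ha2]
    simp only [Pi.pow_apply, Pi.neg_apply]
    field_simp
    push_cast
    ring_nf
    rw [h1]
    ring
  have d3 : ∀ x, HasDerivAt (fun x => c * Q x - Q x ^ 3) (c * P x - 3 * Q x ^ 2 * P x) x :=
    fun x => by
      refine (((d1 x).const_mul c).sub ((d1 x).pow 3)).congr_deriv ?_
      norm_num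
  have d4 : ∀ x, HasDerivAt (fun x => c * P x - 3 * Q x ^ 2 * P x)
      (c * (c * Q x - Q x ^ 3) - (6 * Q x * P x * P x + 3 * Q x ^ 2 * (c * Q x - Q x ^ 3))) x :=
    fun x => by
      refine (((d2 x).const_mul c).sub ((((d1 x).pow 2).const_mul 3).mul (d2 x))).congr_deriv ?_
      simp only [Pi.pow_apply]
      push_cast
      ring
  have f1 : deriv Q = P := funext fun x => (d1 x).deriv
  have f2 : deriv P = fun x => c * Q x - Q x ^ 3 := funext fun x => (d2 x).deriv
  have f3 := funext fun x => (d3 x).deriv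
  intro x
  have f4 : iteratedDeriv 4 Q x = c * (c * Q x - Q x ^ 3) -
      (6 * Q x * P x * P x + 3 * Q x ^ 2 * (c * Q x - Q x ^ 3)) := by
    simp only [iteratedDeriv_succ, iteratedDeriv_zero]
    rw [f1, f2, f3]
    exact (d4 x).deriv
  rw [f4, f1, f2]
  have h := hPsq x
  linear_combination (-Q x) * h
end

section
/- Let α, β > 0 and x₁, x₂ ∈ ℝ. Set δ := α² − 3β², γ := 3α² − β², and for (t,x) ∈ ℝ² set y₁ := x + δ·t + x₁, y₂ := x + γ·t + x₂, and define the breather B(t,x) := 2√2·∂_x[arctan((β/α)·sin(α·y₁)/cosh(β·y₂))]. Then B is a smooth function on ℝ² and solves the modified Korteweg–de Vries equation pointwise: for all (t,x) ∈ ℝ², ∂_t B(t,x) + ∂_x(∂_{xx} B + B³)(t,x) = 0. -/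
/-- Derivative of a quotient by a power. -/
theorem br_quot {N D : ℝ → ℝ} {y N' D' : ℝ} (n : ℕ) (hN : HasDerivAt N N' y)
    (hD : HasDerivAt D D' y) (h0 : D y ≠ 0) :
    HasDerivAt (fun y => N y / D y ^ (n + 1))
      ((N' * D y - (n + 1) * N y * D') / D y ^ (n + 2)) y := by
  have h := hN.fun_div (hD.fun_pow (n + 1)) (pow_ne_zero _ h0)
  refine h.congr_deriv ?_
  rw [div_eq_div_iff (by positivity) (by positivity)]
  push_cast
  ring

set_option maxHeartbeats 4000000 in
theorem br_step1 (α β : ℝ) (s c S C : ℝ → ℝ) (y : ℝ)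
    (hs : HasDerivAt s (α * c y) y) (hc : HasDerivAt c (-(α * s y)) y)
    (hS : HasDerivAt S (β * C y) y) (hC : HasDerivAt C (β * S y) y)
    (h1 : s y ^ 2 + c y ^ 2 = 1) (h2 : C y ^ 2 - S y ^ 2 = 1)
    (h0 : (α^2*(C y)^2 + β^2*(s y)^2) ≠ 0) :
    HasDerivAt (fun y => (α*(c y)*(C y) - β*(s y)*(S y)) / (α^2*(C y)^2 + β^2*(s y)^2)^1)
      ((-α^4*(s y)*(C y)^3 - 2*α^3*β*(c y)*(S y)*(C y)^2 + α^2*β^2*(s y)^3*(C y) + α^2*β^2*(s y)*(C y)^3 - 4*α^2*β^2*(s y)*(C y) + 2*α*β^3*(s y)^2*(c y)*(S y) - β^4*(s y)^3*(C y)) / (α^2*(C y)^2 + β^2*(s y)^2)^2) y := by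
  have hD : HasDerivAt (fun y => (α^2*(C y)^2 + β^2*(s y)^2)) (2*α^2*β*(S y)*(C y) + 2*α*β^2*(s y)*(c y)) y := by
    apply HasDerivAt.congr_deriv
    ·
      repeat' first
        | exact hs | exact hc | exact hS | exact hC
        | exact hasDerivAt_const _ _
        | with_reducible apply HasDerivAt.fun_pow
        | with_reducible apply HasDerivAt.fun_add | with_reducible apply HasDerivAt.fun_sub | with_reducible apply HasDerivAt.fun_neg
        | with_reducible apply HasDerivAt.fun_mul
    · push_cast; ring
  have hN : HasDerivAt (fun y => α*(c y)*(C y) - β*(s y)*(S y)) (-α^2*(s y)*(C y) - β^2*(s y)*(C y)) y := by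
    apply HasDerivAt.congr_deriv
    ·
      repeat' first
        | exact hs | exact hc | exact hS | exact hC
        | exact hasDerivAt_const _ _
        | with_reducible apply HasDerivAt.fun_pow
        | with_reducible apply HasDerivAt.fun_add | with_reducible apply HasDerivAt.fun_sub | with_reducible apply HasDerivAt.fun_neg
        | with_reducible apply HasDerivAt.fun_mul
    · push_cast; ring
  refine (br_quot 0 hN hD h0).congr_deriv ?_
  congr 1
  push_cast
  linear_combination (-2*α^2*β^2*(s y)*(C y)) * h1 - (2*α^2*β^2*(s y)*(C y)) * h2

set_option maxHeartbeats 4000000 in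
theorem br_step2 (α β : ℝ) (s c S C : ℝ → ℝ) (y : ℝ)
    (hs : HasDerivAt s (α * c y) y) (hc : HasDerivAt c (-(α * s y)) y)
    (hS : HasDerivAt S (β * C y) y) (hC : HasDerivAt C (β * S y) y)
    (h1 : s y ^ 2 + c y ^ 2 = 1) (h2 : C y ^ 2 - S y ^ 2 = 1)
    (h0 : (α^2*(C y)^2 + β^2*(s y)^2) ≠ 0) :
    HasDerivAt (fun y => (-α^4*(s y)*(C y)^3 - 2*α^3*β*(c y)*(S y)*(C y)^2 + α^2*β^2*(s y)^3*(C y) + α^2*β^2*(s y)*(C y)^3 - 4*α^2*β^2*(s y)*(C y) + 2*α*β^3*(s y)^2*(c y)*(S y) - β^4*(s y)^3*(C y)) / (α^2*(C y)^2 + β^2*(s y)^2)^2)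
      ((-α^7*(c y)*(C y)^5 + 3*α^6*β*(s y)*(S y)*(C y)^4 + 6*α^5*β^2*(s y)^2*(c y)*(C y)^3 + 3*α^5*β^2*(c y)*(C y)^5 - 8*α^5*β^2*(c y)*(C y)^3 - 18*α^4*β^3*(s y)^3*(S y)*(C y)^2 - α^4*β^3*(s y)*(S y)*(C y)^4 + 24*α^4*β^3*(s y)*(S y)*(C y)^2 - α^3*β^4*(s y)^4*(c y)*(C y) - 18*α^3*β^4*(s y)^2*(c y)*(C y)^3 + 24*α^3*β^4*(s y)^2*(c y)*(C y) + 3*α^2*β^5*(s y)^5*(S y) + 6*α^2*β^5*(s y)^3*(S y)*(C y)^2 - 8*α^2*β^5*(s y)^3*(S y) + 3*α*β^6*(s y)^4*(c y)*(C y) - β^7*(s y)^5*(S y)) / (α^2*(C y)^2 + β^2*(s y)^2)^3) y := by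
  have hD : HasDerivAt (fun y => (α^2*(C y)^2 + β^2*(s y)^2)) (2*α^2*β*(S y)*(C y) + 2*α*β^2*(s y)*(c y)) y := by
    apply HasDerivAt.congr_deriv
    ·
      repeat' first
        | exact hs | exact hc | exact hS | exact hC
        | exact hasDerivAt_const _ _
        | with_reducible apply HasDerivAt.fun_pow
        | with_reducible apply HasDerivAt.fun_add | with_reducible apply HasDerivAt.fun_sub | with_reducible apply HasDerivAt.fun_neg
        | with_reducible apply HasDerivAt.fun_mul
    · push_cast; ring
  have hN : HasDerivAt (fun y => -α^4*(s y)*(C y)^3 - 2*α^3*β*(c y)*(S y)*(C y)^2 + α^2*β^2*(s y)^3*(C y) + α^2*β^2*(s y)*(C y)^3 - 4*α^2*β^2*(s y)*(C y) + 2*α*β^3*(s y)^2*(c y)*(S y) - β^4*(s y)^3*(C y)) (-α^5*(c y)*(C y)^3 - α^4*β*(s y)*(S y)*(C y)^2 + 3*α^3*β^2*(s y)^2*(c y)*(C y) - 4*α^3*β^2*(c y)*(S y)^2*(C y) - α^3*β^2*(c y)*(C y)^3 - 4*α^3*β^2*(c y)*(C y) - α^2*β^3*(s y)^3*(S y) +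 4*α^2*β^3*(s y)*(c y)^2*(S y) + 3*α^2*β^3*(s y)*(S y)*(C y)^2 - 4*α^2*β^3*(s y)*(S y) - α*β^4*(s y)^2*(c y)*(C y) - β^5*(s y)^3*(S y)) y := by
    apply HasDerivAt.congr_deriv
    ·
      repeat' first
        | exact hs | exact hc | exact hS | exact hC
        | exact hasDerivAt_const _ _
        | with_reducible apply HasDerivAt.fun_pow
        | with_reducible apply HasDerivAt.fun_add | with_reducible apply HasDerivAt.fun_sub | with_reducible apply HasDerivAt.fun_neg
        | with_reducible apply HasDerivAt.fun_mul
    · push_cast; ring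
  refine (br_quot 1 hN hD h0).congr_deriv ?_
  congr 1
  push_cast
  linear_combination (12*α^4*β^3*(s y)*(S y)*(C y)^2 - 4*α^2*β^5*(s y)^3*(S y)) * h1 - (4*α^5*β^2*(c y)*(C y)^3 - 12*α^3*β^4*(s y)^2*(c y)*(C y)) * h2

set_option maxHeartbeats 4000000 in
theorem br_step3 (α β : ℝ) (s c S C : ℝ → ℝ) (y : ℝ)
    (hs : HasDerivAt s (α * c y) y) (hc : HasDerivAt c (-(α * s y)) y)
    (hS : HasDerivAt S (β * C y) y) (hC : HasDerivAt C (β * S y) y)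
    (h1 : s y ^ 2 + c y ^ 2 = 1) (h2 : C y ^ 2 - S y ^ 2 = 1)
    (h0 : (α^2*(C y)^2 + β^2*(s y)^2) ≠ 0) :
    HasDerivAt (fun y => (-α^7*(c y)*(C y)^5 + 3*α^6*β*(s y)*(S y)*(C y)^4 + 6*α^5*β^2*(s y)^2*(c y)*(C y)^3 + 3*α^5*β^2*(c y)*(C y)^5 - 8*α^5*β^2*(c y)*(C y)^3 - 18*α^4*β^3*(s y)^3*(S y)*(C y)^2 - α^4*β^3*(s y)*(S y)*(C y)^4 + 24*α^4*β^3*(s y)*(S y)*(C y)^2 - α^3*β^4*(s y)^4*(c y)*(C y) - 18*α^3*β^4*(s y)^2*(c y)*(C y)^3 + 24*α^3*β^4*(s y)^2*(c y)*(C y) + 3*α^2*β^5*(s y)^5*(S y) + 6*α^2*β^5*(s y)^3*(S y)*(C y)^2 - 8*α^2*β^5*(s y)^3*(S y) + 3*α*β^6*(s y)^4*(c y)*(C y) - β^7*(s y)^5*(S y)) / (α^2*(C y)^2 + β^2*(s y)^2)^3)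
      ((α^10*(s y)*(C y)^7 + 4*α^9*β*(c y)*(S y)*(C y)^6 - 23*α^8*β^2*(s y)^3*(C y)^5 - 6*α^8*β^2*(s y)*(C y)^7 + 32*α^8*β^2*(s y)*(C y)^5 - 92*α^7*β^3*(s y)^2*(c y)*(S y)*(C y)^4 - 4*α^7*β^3*(c y)*(S y)*(C y)^6 + 48*α^7*β^3*(c y)*(S y)*(C y)^4 + 23*α^6*β^4*(s y)^5*(C y)^3 + 138*α^6*β^4*(s y)^3*(C y)^5 - 224*α^6*β^4*(s y)^3*(C y)^3 + α^6*β^4*(s y)*(C y)^7 - 128*α^6*β^4*(s y)*(C y)^5 + 192*α^6*β^4*(s y)*(C y)^3 + 92*α^5*β^5*(s y)^4*(c y)*(S y)*(C y)^2 + 92*α^5*β^5*(s y)^2*(c y)*(S y)*(C y)^4 - 288*α^5*β^5*(s y)^2*(c y)*(S y)*(C y)^2 - α^4*β^6*(s y)^7*(C y) - 138*α^4*β^6*(s y)^5*(C y)^3 + 128*α^4*β^6*(s y)^5*(C y) - 23*α^4*β^6*(s y)^3*(C y)^5 + 224*α^4*β^6*(s y)^3*(C y)^3 - 192*α^4*β^6*(s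 y)^3*(C y) - 4*α^3*β^7*(s y)^6*(c y)*(S y) - 92*α^3*β^7*(s y)^4*(c y)*(S y)*(C y)^2 + 48*α^3*β^7*(s y)^4*(c y)*(S y) + 6*α^2*β^8*(s y)^7*(C y) + 23*α^2*β^8*(s y)^5*(C y)^3 - 32*α^2*β^8*(s y)^5*(C y) + 4*α*β^9*(s y)^6*(c y)*(S y) - β^10*(s y)^7*(C y)) / (α^2*(C y)^2 + β^2*(s y)^2)^4) y := by
  have hD : HasDerivAt (fun y => (α^2*(C y)^2 + β^2*(s y)^2)) (2*α^2*β*(S y)*(C y) + 2*α*β^2*(s y)*(c y)) y := by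
    apply HasDerivAt.congr_deriv
    ·
      repeat' first
        | exact hs | exact hc | exact hS | exact hC
        | exact hasDerivAt_const _ _
        | with_reducible apply HasDerivAt.fun_pow
        | with_reducible apply HasDerivAt.fun_add | with_reducible apply HasDerivAt.fun_sub | with_reducible apply HasDerivAt.fun_neg
        | with_reducible apply HasDerivAt.fun_mul
    · push_cast; ring
  have hN : HasDerivAt (fun y => -α^7*(c y)*(C y)^5 + 3*α^6*β*(s y)*(S y)*(C y)^4 + 6*α^5*β^2*(s y)^2*(c y)*(C y)^3 + 3*α^5*β^2*(c y)*(C y)^5 - 8*α^5*β^2*(c y)*(C y)^3 - 18*α^4*β^3*(s y)^3*(S y)*(C y)^2 - α^4*β^3*(s y)*(S y)*(C y)^4 + 24*α^4*β^3*(s y)*(S y)*(C y)^2 - α^3*β^4*(s y)^4*(c y)*(C y) - 18*α^3*β^4*(s y)^2*(c y)*(C y)^3 + 24*α^3*β^4*(s y)^2*(c y)*(C y) + 3*α^2*β^5*(s y)^5*(S y) + 6*α^2*β^5*(s y)^3*(S y)*(C y)^2 - 8*α^2*β^5*(s y)^3*(S y) + 3*α*β^6*(s y)^4*(c y)*(C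 y) - β^7*(s y)^5*(S y)) (α^8*(s y)*(C y)^5 - 2*α^7*β*(c y)*(S y)*(C y)^4 - 6*α^6*β^2*(s y)^3*(C y)^3 + 12*α^6*β^2*(s y)*(c y)^2*(C y)^3 + 12*α^6*β^2*(s y)*(S y)^2*(C y)^3 + 8*α^6*β^2*(s y)*(C y)^3 - 36*α^5*β^3*(s y)^2*(c y)*(S y)*(C y)^2 + 14*α^5*β^3*(c y)*(S y)*(C y)^4 + α^4*β^4*(s y)^5*(C y) - 4*α^4*β^4*(s y)^3*(c y)^2*(C y) - 36*α^4*β^4*(s y)^3*(S y)^2*(C y) - 24*α^4*β^4*(s y)^3*(C y) - 36*α^4*β^4*(s y)*(c y)^2*(C y)^3 + 48*α^4*β^4*(s y)*(c y)^2*(C y) - 4*α^4*β^4*(s y)*(S y)^2*(C y)^3 + 48*α^4*β^4*(s y)*(S y)^2*(C y) - α^4*β^4*(s y)*(C y)^5 + 24*α^4*β^4*(s y)*(C y)^3 + 14*α^3*β^5*(s y)^4*(c y)*(S y) - 36*α^3*β^5*(s y)^2*(c y)*(S y)*(C y)^2 + 12*α^2*β^6*(s y)^3*(c y)^2*(C y)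 + 12*α^2*β^6*(s y)^3*(S y)^2*(C y) + 6*α^2*β^6*(s y)^3*(C y)^3 - 8*α^2*β^6*(s y)^3*(C y) - 2*α*β^7*(s y)^4*(c y)*(S y) - β^8*(s y)^5*(C y)) y := by
    apply HasDerivAt.congr_deriv
    ·
      repeat' first
        | exact hs | exact hc | exact hS | exact hC
        | exact hasDerivAt_const _ _
        | with_reducible apply HasDerivAt.fun_pow
        | with_reducible apply HasDerivAt.fun_add | with_reducible apply HasDerivAt.fun_sub | with_reducible apply HasDerivAt.fun_neg
        | with_reducible apply HasDerivAt.fun_mul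
    · push_cast; ring
  refine (br_quot 2 hN hD h0).congr_deriv ?_
  congr 1
  push_cast
  linear_combination (18*α^8*β^2*(s y)*(C y)^5 - 28*α^6*β^4*(s y)^3*(C y)^3 - 54*α^6*β^4*(s y)*(C y)^5 + 96*α^6*β^4*(s y)*(C y)^3 + 2*α^4*β^6*(s y)^5*(C y) + 84*α^4*β^6*(s y)^3*(C y)^3 - 96*α^4*β^6*(s y)^3*(C y) - 6*α^2*β^8*(s y)^5*(C y)) * h1 - (-6*α^8*β^2*(s y)*(C y)^5 + 84*α^6*β^4*(s y)^3*(C y)^3 + 2*α^6*β^4*(s y)*(C y)^5 - 96*α^6*β^4*(s y)*(C y)^3 - 54*α^4*β^6*(s y)^5*(C y) - 28*α^4*β^6*(s y)^3*(C y)^3 + 96*α^4*β^6*(s y)^3*(C y) + 18*α^2*β^8*(s y)^5*(C y)) * h2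

set_option maxHeartbeats 4000000 in
theorem br_stept (α β : ℝ) (s c S C : ℝ → ℝ) (y : ℝ)
    (hs : HasDerivAt s ((α * (α^2 - 3*β^2)) * c y) y) (hc : HasDerivAt c (-((α * (α^2 - 3*β^2)) * s y)) y)
    (hS : HasDerivAt S ((β * (3*α^2 - β^2)) * C y) y) (hC : HasDerivAt C ((β * (3*α^2 - β^2)) * S y) y)
    (h1 : s y ^ 2 + c y ^ 2 = 1) (h2 : C y ^ 2 - S y ^ 2 = 1)
    (h0 : (α^2*(C y)^2 + β^2*(s y)^2) ≠ 0) :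
    HasDerivAt (fun y => (α*(c y)*(C y) - β*(s y)*(S y)) / (α^2*(C y)^2 + β^2*(s y)^2)^1)
      ((-α^6*(s y)*(C y)^3 - 4*α^5*β*(c y)*(S y)*(C y)^2 + α^4*β^2*(s y)^3*(C y) + 6*α^4*β^2*(s y)*(C y)^3 - 8*α^4*β^2*(s y)*(C y) + 4*α^3*β^3*(s y)^2*(c y)*(S y) + 4*α^3*β^3*(c y)*(S y)*(C y)^2 - 6*α^2*β^4*(s y)^3*(C y) - α^2*β^4*(s y)*(C y)^3 + 8*α^2*β^4*(s y)*(C y) - 4*α*β^5*(s y)^2*(c y)*(S y) + β^6*(s y)^3*(C y)) / (α^2*(C y)^2 + β^2*(s y)^2)^2) y := by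
  have hD : HasDerivAt (fun y => (α^2*(C y)^2 + β^2*(s y)^2)) (6*α^4*β*(S y)*(C y) + 2*α^3*β^2*(s y)*(c y) - 2*α^2*β^3*(S y)*(C y) - 6*α*β^4*(s y)*(c y)) y := by
    apply HasDerivAt.congr_deriv
    ·
      repeat' first
        | exact hs | exact hc | exact hS | exact hC
        | exact hasDerivAt_const _ _
        | with_reducible apply HasDerivAt.fun_pow
        | with_reducible apply HasDerivAt.fun_add | with_reducible apply HasDerivAt.fun_sub | with_reducible apply HasDerivAt.fun_neg
        | with_reducible apply HasDerivAt.fun_mul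
    · push_cast; ring
  have hN : HasDerivAt (fun y => α*(c y)*(C y) - β*(s y)*(S y)) (-α^4*(s y)*(C y) + 2*α^3*β*(c y)*(S y) + 2*α*β^3*(c y)*(S y) + β^4*(s y)*(C y)) y := by
    apply HasDerivAt.congr_deriv
    ·
      repeat' first
        | exact hs | exact hc | exact hS | exact hC
        | exact hasDerivAt_const _ _
        | with_reducible apply HasDerivAt.fun_pow
        | with_reducible apply HasDerivAt.fun_add | with_reducible apply HasDerivAt.fun_sub | with_reducible apply HasDerivAt.fun_neg
        | with_reducible apply HasDerivAt.fun_mul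
    · push_cast; ring
  refine (br_quot 0 hN hD h0).congr_deriv ?_
  congr 1
  push_cast
  linear_combination (-2*α^4*β^2*(s y)*(C y) + 6*α^2*β^4*(s y)*(C y)) * h1 - (6*α^4*β^2*(s y)*(C y) - 2*α^2*β^4*(s y)*(C y)) * h2

set_option maxHeartbeats 4000000 in
theorem br_alg (α β s c S C k : ℝ) (hk : k^2 = 8 * α^2 * β^2)
    (h1 : s ^ 2 + c ^ 2 = 1) (h2 : C ^ 2 - S ^ 2 = 1) (h0 : (α^2*C^2 + β^2*s^2) ≠ 0) :
    k * ((-α^6*s*C^3 - 4*α^5*β*c*S*C^2 + α^4*β^2*s^3*C + 6*α^4*β^2*s*C^3 - 8*α^4*β^2*s*C + 4*α^3*β^3*s^2*c*S + 4*α^3*β^3*c*S*C^2 - 6*α^2*β^4*s^3*C - α^2*β^4*s*C^3 + 8*α^2*β^4*s*C - 4*α*β^5*s^2*c*S + β^6*s^3*C) / (α^2*C^2 + β^2*s^2)^2) + (k * ((α^10*s*C^7 + 4*α^9*β*c*S*C^6 - 23*α^8*β^2*s^3*C^5 - 6*α^8*β^2*s*C^7 + 32*α^8*β^2*s*C^5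 - 92*α^7*β^3*s^2*c*S*C^4 - 4*α^7*β^3*c*S*C^6 + 48*α^7*β^3*c*S*C^4 + 23*α^6*β^4*s^5*C^3 + 138*α^6*β^4*s^3*C^5 - 224*α^6*β^4*s^3*C^3 + α^6*β^4*s*C^7 - 128*α^6*β^4*s*C^5 + 192*α^6*β^4*s*C^3 + 92*α^5*β^5*s^4*c*S*C^2 + 92*α^5*β^5*s^2*c*S*C^4 - 288*α^5*β^5*s^2*c*S*C^2 - α^4*β^6*s^7*C - 138*α^4*β^6*s^5*C^3 + 128*α^4*β^6*s^5*C - 23*α^4*β^6*s^3*C^5 + 224*α^4*β^6*s^3*C^3 - 192*α^4*β^6*s^3*C - 4*α^3*β^7*s^6*c*S - 92*α^3*β^7*s^4*c*S*C^2 + 48*α^3*β^7*s^4*c*S + 6*α^2*β^8*s^7*C + 23*α^2*β^8*s^5*C^3 - 32*α^2*β^8*s^5*C + 4*α*β^9*s^6*c*S - β^10*s^7*C) / (α^2*C^2 + β^2*s^2)^4)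
      + 3 * (k * ((α*c*C - β*s*S) / (α^2*C^2 + β^2*s^2)^1))^2 * (k * ((-α^4*s*C^3 - 2*α^3*β*c*S*C^2 + α^2*β^2*s^3*C + α^2*β^2*s*C^3 - 4*α^2*β^2*s*C + 2*α*β^3*s^2*c*S - β^4*s^3*C) / (α^2*C^2 + β^2*s^2)^2))) = 0 := by
  have key : (-α^6*s*C^3 - 4*α^5*β*c*S*C^2 + α^4*β^2*s^3*C + 6*α^4*β^2*s*C^3 - 8*α^4*β^2*s*C + 4*α^3*β^3*s^2*c*S + 4*α^3*β^3*c*S*C^2 - 6*α^2*β^4*s^3*C - α^2*β^4*s*C^3 + 8*α^2*β^4*s*C - 4*α*β^5*s^2*c*S + β^6*s^3*C) * (α^2*C^2 + β^2*s^2)^2 + (α^10*s*C^7 + 4*α^9*β*c*S*C^6 - 23*α^8*β^2*s^3*C^5 - 6*α^8*β^2*s*C^7 + 32*α^8*β^2*s*C^5 - 92*α^7*β^3*s^2*c*S*C^4 - 4*α^7*β^3*c*S*C^6 + 48*α^7*β^3*c*S*C^4 + 23*α^6*β^4*s^5*C^3 + 138*α^6*β^4*s^3*C^5 - 224*α^6*β^4*s^3*C^3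 + α^6*β^4*s*C^7 - 128*α^6*β^4*s*C^5 + 192*α^6*β^4*s*C^3 + 92*α^5*β^5*s^4*c*S*C^2 + 92*α^5*β^5*s^2*c*S*C^4 - 288*α^5*β^5*s^2*c*S*C^2 - α^4*β^6*s^7*C - 138*α^4*β^6*s^5*C^3 + 128*α^4*β^6*s^5*C - 23*α^4*β^6*s^3*C^5 + 224*α^4*β^6*s^3*C^3 - 192*α^4*β^6*s^3*C - 4*α^3*β^7*s^6*c*S - 92*α^3*β^7*s^4*c*S*C^2 + 48*α^3*β^7*s^4*c*S + 6*α^2*β^8*s^7*C + 23*α^2*β^8*s^5*C^3 - 32*α^2*β^8*s^5*C + 4*α*β^9*s^6*c*S - β^10*s^7*C) + 24 * α^2 * β^2 * (α*c*C - β*s*S)^2 * (-α^4*s*C^3 - 2*α^3*β*c*S*C^2 + α^2*β^2*s^3*C + α^2*β^2*s*C^3 - 4*α^2*β^2*s*C + 2*α*β^3*s^2*c*S - β^4*s^3*C) = 0 := by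
    linear_combination (-24*α^8*β^2*s*C^5 - 48*α^7*β^3*c*S*C^4 + 24*α^6*β^4*s^3*C^3 + 96*α^6*β^4*s*S^2*C^3 + 24*α^6*β^4*s*C^5 - 96*α^6*β^4*s*C^3 + 48*α^5*β^5*s^2*c*S*C^2 - 96*α^4*β^6*s^3*S^2*C - 24*α^4*β^6*s^3*C^3) * h1 - (-120*α^6*β^4*s^3*C^3 + 96*α^6*β^4*s*C^3 - 48*α^5*β^5*s^2*c*S*C^2 + 120*α^4*β^6*s^5*C + 24*α^4*β^6*s^3*C^3 - 192*α^4*β^6*s^3*C + 48*α^3*β^7*s^4*c*S - 24*α^2*β^8*s^5*C) * h2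
  generalize (-α^6*s*C^3 - 4*α^5*β*c*S*C^2 + α^4*β^2*s^3*C + 6*α^4*β^2*s*C^3 - 8*α^4*β^2*s*C + 4*α^3*β^3*s^2*c*S + 4*α^3*β^3*c*S*C^2 - 6*α^2*β^4*s^3*C - α^2*β^4*s*C^3 + 8*α^2*β^4*s*C - 4*α*β^5*s^2*c*S + β^6*s^3*C) = T at *
  generalize (α^10*s*C^7 + 4*α^9*β*c*S*C^6 - 23*α^8*β^2*s^3*C^5 - 6*α^8*β^2*s*C^7 + 32*α^8*β^2*s*C^5 - 92*α^7*β^3*s^2*c*S*C^4 - 4*α^7*β^3*c*S*C^6 + 48*α^7*β^3*c*S*C^4 + 23*α^6*β^4*s^5*C^3 + 138*α^6*β^4*s^3*C^5 - 224*α^6*β^4*s^3*C^3 + α^6*β^4*s*C^7 - 128*α^6*β^4*s*C^5 + 192*α^6*β^4*s*C^3 + 92*α^5*β^5*s^4*c*S*C^2 + 92*α^5*β^5*s^2*c*S*C^4 - 288*α^5*β^5*s^2*c*S*C^2 - α^4*β^6*s^7*C - 138*α^4*β^6*s^5*C^3 + 128*α^4*β^6*s^5*C - 23*α^4*β^6*s^3*C^5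 + 224*α^4*β^6*s^3*C^3 - 192*α^4*β^6*s^3*C - 4*α^3*β^7*s^6*c*S - 92*α^3*β^7*s^4*c*S*C^2 + 48*α^3*β^7*s^4*c*S + 6*α^2*β^8*s^7*C + 23*α^2*β^8*s^5*C^3 - 32*α^2*β^8*s^5*C + 4*α*β^9*s^6*c*S - β^10*s^7*C) = X at *
  generalize (-α^4*s*C^3 - 2*α^3*β*c*S*C^2 + α^2*β^2*s^3*C + α^2*β^2*s*C^3 - 4*α^2*β^2*s*C + 2*α*β^3*s^2*c*S - β^4*s^3*C) = Y at *
  generalize (α*c*C - β*s*S) = N at *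
  generalize (α^2*C^2 + β^2*s^2) = D at *
  have e : k * (T / D^2) + (k * (X / D^4) + 3 * (k * (N / D^1))^2 * (k * (Y / D^2)))
      = k * (T * D^2 + X + 3 * k^2 * N^2 * Y) / D^4 := by
    field_simp
    ring
  rw [e, hk]
  have : T * D^2 + X + 3 * (8 * α^2 * β^2) * N^2 * Y = 0 := by linear_combination key
  rw [this]; simp

/-- For `α, β > 0` and `x₁, x₂ ∈ ℝ`, with `δ := α² − 3β²`, `γ := 3α² − β²`,
the breather `B(t,x) := 2√2·∂_x[arctan((β/α)·sin(α·(x+δt+x₁))/cosh(β·(x+γt+x₂)))]`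
is smooth on `ℝ²` and solves mKdV pointwise: `∂_t B + ∂_x(∂_{xx}B + B³) = 0`. -/
theorem breather_solves_mKdV (α β : ℝ) (hα : 0 < α) (hβ : 0 < β) (x₁ x₂ : ℝ)
    (B : ℝ → ℝ → ℝ)
    (hB : ∀ t x : ℝ, B t x =
      2 * Real.sqrt 2 * deriv (fun y : ℝ =>
        Real.arctan ((β / α) * Real.sin (α * (y + (α ^ 2 - 3 * β ^ 2) * t + x₁))
          / Real.cosh (β * (y + (3 * α ^ 2 - β ^ 2) * t + x₂)))) x) :
    ContDiff ℝ (⊤ : ℕ∞) (fun p : ℝ × ℝ => B p.1 p.2) ∧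
    ∀ t x : ℝ,
      deriv (fun s => B s x) t
        + deriv (fun y => deriv (deriv (B t)) y + (B t y) ^ 3) x = 0 := by
  obtain ⟨s, hsd⟩ : ∃ s : ℝ → ℝ → ℝ, s = fun t y =>
    Real.sin (α * (y + (α ^ 2 - 3 * β ^ 2) * t + x₁)) := ⟨_, rfl⟩
  obtain ⟨c, hcd⟩ : ∃ s : ℝ → ℝ → ℝ, s = fun t y =>
    Real.cos (α * (y + (α ^ 2 - 3 * β ^ 2) * t + x₁)) := ⟨_, rfl⟩
  obtain ⟨S, hSd⟩ : ∃ s : ℝ → ℝ → ℝ, s = fun t y =>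
    Real.sinh (β * (y + (3 * α ^ 2 - β ^ 2) * t + x₂)) := ⟨_, rfl⟩
  obtain ⟨C, hCd⟩ : ∃ s : ℝ → ℝ → ℝ, s = fun t y =>
    Real.cosh (β * (y + (3 * α ^ 2 - β ^ 2) * t + x₂)) := ⟨_, rfl⟩
  have l1 : ∀ t y, HasDerivAt (fun y => α * (y + (α ^ 2 - 3 * β ^ 2) * t + x₁)) α y := by
    intro t y
    simpa using (((hasDerivAt_id y).add_const ((α ^ 2 - 3 * β ^ 2) * t)).add_const x₁).const_mul α
  have l2 : ∀ t y, HasDerivAt (fun y => β * (y + (3 * α ^ 2 - β ^ 2) * t + x₂)) β y := by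
    intro t y
    simpa using (((hasDerivAt_id y).add_const ((3 * α ^ 2 - β ^ 2) * t)).add_const x₂).const_mul β
  have m1 : ∀ t y, HasDerivAt (fun t => α * (y + (α ^ 2 - 3 * β ^ 2) * t + x₁))
      (α * (α ^ 2 - 3 * β ^ 2)) t := by
    intro t y
    simpa using ((((hasDerivAt_id t).const_mul (α ^ 2 - 3 * β ^ 2)).const_add y).add_const
      x₁).const_mul α
  have m2 : ∀ t y, HasDerivAt (fun t => β * (y + (3 * α ^ 2 - β ^ 2) * t + x₂))
      (β * (3 * α ^ 2 - β ^ 2)) t := by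
    intro t y
    simpa using ((((hasDerivAt_id t).const_mul (3 * α ^ 2 - β ^ 2)).const_add y).add_const
      x₂).const_mul β
  have hs : ∀ t y, HasDerivAt (s t) (α * c t y) y := by
    intro t y; subst hsd hcd; exact (l1 t y).sin.congr_deriv (by ring)
  have hc : ∀ t y, HasDerivAt (c t) (-(α * s t y)) y := by
    intro t y; subst hsd hcd; exact (l1 t y).cos.congr_deriv (by ring)
  have hS : ∀ t y, HasDerivAt (S t) (β * C t y) y := by
    intro t y; subst hSd hCd; exact (l2 t y).sinh.congr_deriv (by ring)
  have hC : ∀ t y, HasDerivAt (C t) (β * S t y) y := by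
    intro t y; subst hSd hCd; exact (l2 t y).cosh.congr_deriv (by ring)
  have hs' : ∀ t y, HasDerivAt (fun t => s t y) ((α * (α^2 - 3*β^2)) * c t y) t := by
    intro t y; subst hsd hcd; exact (m1 t y).sin.congr_deriv (by ring)
  have hc' : ∀ t y, HasDerivAt (fun t => c t y) (-((α * (α^2 - 3*β^2)) * s t y)) t := by
    intro t y; subst hsd hcd; exact (m1 t y).cos.congr_deriv (by ring)
  have hS' : ∀ t y, HasDerivAt (fun t => S t y) ((β * (3*α^2 - β^2)) * C t y) t := by
    intro t y; subst hSd hCd; exact (m2 t y).sinh.congr_deriv (by ring)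
  have hC' : ∀ t y, HasDerivAt (fun t => C t y) ((β * (3*α^2 - β^2)) * S t y) t := by
    intro t y; subst hSd hCd; exact (m2 t y).cosh.congr_deriv (by ring)
  have h1 : ∀ t y, s t y ^ 2 + c t y ^ 2 = 1 := by
    intro t y; subst hsd hcd; exact Real.sin_sq_add_cos_sq _
  have h2 : ∀ t y, C t y ^ 2 - S t y ^ 2 = 1 := by
    intro t y; subst hSd hCd; exact Real.cosh_sq_sub_sinh_sq _
  have hCp : ∀ t y, 0 < C t y := by
    intro t y; subst hCd; exact Real.cosh_pos _
  have h0 : ∀ t y, (α^2*(C t y)^2 + β^2*(s t y)^2) ≠ 0 := by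
    intro t y
    have := hCp t y
    positivity
  have hB1 : ∀ t y, B t y = (2 * Real.sqrt 2 * (α * β)) *
      ((α*(c t y)*(C t y) - β*(s t y)*(S t y)) / (α^2*(C t y)^2 + β^2*(s t y)^2)^1) := by
    intro t y
    rw [hB]
    have e : (fun y : ℝ =>
        Real.arctan ((β / α) * Real.sin (α * (y + (α ^ 2 - 3 * β ^ 2) * t + x₁))
          / Real.cosh (β * (y + (3 * α ^ 2 - β ^ 2) * t + x₂))))
        = fun y => Real.arctan ((β / α) * s t y / C t y) := by
      subst hsd hCd; rfl
    have hd := ((((hs t y).const_mul (β / α)).fun_div (hC t y) (hCp t y).ne')).arctan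
    rw [e, hd.deriv, mul_assoc (2 * Real.sqrt 2)]
    congr 1
    have h0' := h0 t y
    have hC0 := (hCp t y).ne'
    have h3 : 1 + (β / α * s t y / C t y) ^ 2
        = (α^2*(C t y)^2 + β^2*(s t y)^2) / (α * C t y)^2 := by
      field_simp
    rw [h3]
    field_simp
    try ring
  have hBf : ∀ t, B t = fun y => (2 * Real.sqrt 2 * (α * β)) *
      ((α*(c t y)*(C t y) - β*(s t y)*(S t y)) / (α^2*(C t y)^2 + β^2*(s t y)^2)^1) :=
    fun t => funext (hB1 t)
  constructor
  · have e : (fun p : ℝ × ℝ => B p.1 p.2) = fun p : ℝ × ℝ => (2 * Real.sqrt 2 * (α * β)) *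
      ((α*(c p.1 p.2)*(C p.1 p.2) - β*(s p.1 p.2)*(S p.1 p.2)) /
        (α^2*(C p.1 p.2)^2 + β^2*(s p.1 p.2)^2)^1) := funext fun p => hB1 p.1 p.2
    rw [e]
    have cs : ContDiff ℝ (⊤ : ℕ∞) (fun p : ℝ × ℝ => s p.1 p.2) := by
      subst hsd; fun_prop
    have cc : ContDiff ℝ (⊤ : ℕ∞) (fun p : ℝ × ℝ => c p.1 p.2) := by
      subst hcd; fun_prop
    have cS : ContDiff ℝ (⊤ : ℕ∞) (fun p : ℝ × ℝ => S p.1 p.2) := by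
      subst hSd; exact ContDiff.sinh (by fun_prop)
    have cC : ContDiff ℝ (⊤ : ℕ∞) (fun p : ℝ × ℝ => C p.1 p.2) := by
      subst hCd; exact ContDiff.cosh (by fun_prop)
    refine contDiff_const.mul (ContDiff.div (by fun_prop) (by fun_prop) ?_)
    intro p
    exact pow_ne_zero _ (h0 _ _)
  · intro t x
    have d1 := fun y => (br_step1 α β (s t) (c t) (S t) (C t) y (hs t y) (hc t y) (hS t y)
      (hC t y) (h1 t y) (h2 t y) (h0 t y)).const_mul (2 * Real.sqrt 2 * (α * β))
    have d2 := fun y => (br_step2 α β (s t) (c t) (S t) (C t) y (hs t y) (hc t y) (hS t y)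
      (hC t y) (h1 t y) (h2 t y) (h0 t y)).const_mul (2 * Real.sqrt 2 * (α * β))
    have d3 := fun y => (br_step3 α β (s t) (c t) (S t) (C t) y (hs t y) (hc t y) (hS t y)
      (hC t y) (h1 t y) (h2 t y) (h0 t y)).const_mul (2 * Real.sqrt 2 * (α * β))
    have dt := (br_stept α β (fun t => s t x) (fun t => c t x) (fun t => S t x)
      (fun t => C t x) t (hs' t x) (hc' t x) (hS' t x)
      (hC' t x) (h1 t x) (h2 t x) (h0 t x)).const_mul (2 * Real.sqrt 2 * (α * β))
    have e1 := funext fun y => (d1 y).deriv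
    have e2 := funext fun y => (d2 y).deriv
    have et : (fun r => B r x) = _ := funext fun r => hB1 r x
    have eB : deriv (deriv (B t)) = fun y => (2 * Real.sqrt 2 * (α * β)) *
        ((-α^7*(c t y)*(C t y)^5 + 3*α^6*β*(s t y)*(S t y)*(C t y)^4 + 6*α^5*β^2*(s t y)^2*(c t y)*(C t y)^3 + 3*α^5*β^2*(c t y)*(C t y)^5 - 8*α^5*β^2*(c t y)*(C t y)^3 - 18*α^4*β^3*(s t y)^3*(S t y)*(C t y)^2 - α^4*β^3*(s t y)*(S t y)*(C t y)^4 + 24*α^4*β^3*(s t y)*(S t y)*(C t y)^2 - α^3*β^4*(s t y)^4*(c t y)*(C t y) - 18*α^3*β^4*(s t y)^2*(c t y)*(C t y)^3 + 24*α^3*β^4*(s t y)^2*(c t y)*(C t y) + 3*α^2*β^5*(s t y)^5*(S t y) + 6*α^2*β^5*(s t y)^3*(S t y)*(C t y)^2 - 8*α^2*β^5*(s t y)^3*(S t y) + 3*α*β^6*(s t y)^4*(c t y)*(C t y) - β^7*(s t y)^5*(S t y)) / (α^2*(C t y)^2 + β^2*(s t y)^2)^3) := by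
      rw [hBf t]
      exact (congrArg deriv e1).trans e2
    rw [et, dt.deriv, eB]
    have ex := (d3 x).fun_add ((d1 x).fun_pow 3)
    have hk : (2 * Real.sqrt 2 * (α * β))^2 = 8 * α^2 * β^2 := by
      have := Real.sq_sqrt (show (0:ℝ) ≤ 2 by norm_num)
      linear_combination 4 * α^2 * β^2 * this
    rw [hBf t]
    refine Eq.trans (congrArg _ ex.deriv) ?_
    have := br_alg α β (s t x) (c t x) (S t x) (C t x) _ hk (h1 t x) (h2 t x) (h0 t x)
    push_cast
    exact this
end

section
/- Let u : ℝ × ℝ → ℝ be a smooth solution of mKdV (i.e., ∂_t u + ∂_x(∂_{xx}u + u³) = 0 pointwise) such that for every n, k ∈ ℕ the quantity (1+|x|)^k·|∂_x^n u(t,x)| is bounded on [−T,T] × ℝ for every T > 0, and similarly for ∂_t∂_x^n u. Then the second energy F[u](t) := ∫_ℝ ((1/2)·(∂_{xx} u)²(t,x) − (5/2)·u²(t,x)·(∂_x u)²(t,x) + (1/4)·u⁶(t,x)) dx is constant in t. -/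
open MeasureTheory


/-- Bounded after multiplication by `1 + x²`, uniformly for `t` in `[-T, T]`. -/
def GoodDecay (T : ℝ) (f : ℝ → ℝ → ℝ) : Prop :=
  ∃ C : ℝ, ∀ t ∈ Set.Icc (-T) T, ∀ x : ℝ, (1 + x ^ 2) * |f t x| ≤ C

namespace GoodDecay

variable {T : ℝ} {f g : ℝ → ℝ → ℝ}

theorem add (hf : GoodDecay T f) (hg : GoodDecay T g) :
    GoodDecay T (fun t x => f t x + g t x) := by
  obtain ⟨C, hC⟩ := hf
  obtain ⟨D, hD⟩ := hg
  refine ⟨C + D, fun t ht x => ?_⟩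
  have h1 := hC t ht x
  have h2 := hD t ht x
  have h3 := mul_le_mul_of_nonneg_left (abs_add_le (f t x) (g t x))
    (by positivity : (0 : ℝ) ≤ 1 + x ^ 2)
  linarith

theorem cmul (c : ℝ) (hf : GoodDecay T f) : GoodDecay T (fun t x => c * f t x) := by
  obtain ⟨C, hC⟩ := hf
  refine ⟨|c| * C, fun t ht x => ?_⟩
  have h1 := mul_le_mul_of_nonneg_left (hC t ht x) (abs_nonneg c)
  rw [abs_mul]
  linarith

theorem sub (hf : GoodDecay T f) (hg : GoodDecay T g) :
    GoodDecay T (fun t x => f t x - g t x) := by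
  have := hf.add (hg.cmul (-1))
  simpa [sub_eq_add_neg] using this

theorem mul (hf : GoodDecay T f) (hg : GoodDecay T g) :
    GoodDecay T (fun t x => f t x * g t x) := by
  obtain ⟨C, hC⟩ := hf
  obtain ⟨D, hD⟩ := hg
  refine ⟨C * D, fun t ht x => ?_⟩
  have h1 := hC t ht x
  have h2 := hD t ht x
  have h0 : |g t x| ≤ D := by
    nlinarith [abs_nonneg (g t x), mul_nonneg (sq_nonneg x) (abs_nonneg (g t x))]
  rw [abs_mul, ← mul_assoc]
  exact mul_le_mul h1 h0 (abs_nonneg _) (le_trans (by positivity) h1)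

theorem pow (hf : GoodDecay T f) (n : ℕ) : GoodDecay T (fun t x => f t x ^ (n + 1)) := by
  induction n with
  | zero => simpa using hf
  | succ n ih => simpa [pow_succ] using ih.mul hf

theorem integrable (hf : GoodDecay T f) {t : ℝ} (ht : t ∈ Set.Icc (-T) T)
    (hc : Continuous (f t)) : Integrable (f t) := by
  obtain ⟨C, hC⟩ := hf
  refine Integrable.mono' (integrable_inv_one_add_sq.const_mul C) hc.aestronglyMeasurable
    (Filter.Eventually.of_forall fun x => ?_)
  have hp : (0 : ℝ) < 1 + x ^ 2 := by positivity
  rw [Real.norm_eq_abs, ← div_eq_mul_inv, le_div_iff₀ hp, mul_comm]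
  exact hC t ht x

theorem of_decay (h : ∃ C : ℝ, ∀ t ∈ Set.Icc (-T) T, ∀ x : ℝ, (1 + |x|) ^ 2 * |f t x| ≤ C) :
    GoodDecay T f := by
  obtain ⟨C, hC⟩ := h
  refine ⟨C, fun t ht x => le_trans (mul_le_mul_of_nonneg_right ?_ (abs_nonneg _)) (hC t ht x)⟩
  nlinarith [abs_nonneg x, sq_abs x]

end GoodDecay

theorem hasDerivAt_snd_of_smooth {g : ℝ → ℝ → ℝ}
    (hg : ContDiff ℝ (⊤ : ℕ∞) (fun p : ℝ × ℝ => g p.1 p.2)) (t x : ℝ) :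
    HasDerivAt (g t) (fderiv ℝ (fun p : ℝ × ℝ => g p.1 p.2) (t, x) (0, 1)) x := by
  have h1 := ((hg.differentiable (by simp)) (t, x)).hasFDerivAt
  have h2 : HasDerivAt (fun y : ℝ => (t, y)) ((0 : ℝ), (1 : ℝ)) x :=
    (hasDerivAt_const x t).prodMk (hasDerivAt_id x)
  exact h1.comp_hasDerivAt x h2

theorem hasDerivAt_fst_of_smooth {g : ℝ → ℝ → ℝ}
    (hg : ContDiff ℝ (⊤ : ℕ∞) (fun p : ℝ × ℝ => g p.1 p.2)) (t x : ℝ) :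
    HasDerivAt (fun s => g s x) (fderiv ℝ (fun p : ℝ × ℝ => g p.1 p.2) (t, x) (1, 0)) t := by
  have h1 := ((hg.differentiable (by simp)) (t, x)).hasFDerivAt
  have h2 : HasDerivAt (fun y : ℝ => (y, x)) ((1 : ℝ), (0 : ℝ)) t :=
    (hasDerivAt_id t).prodMk (hasDerivAt_const t x)
  exact h1.comp_hasDerivAt t h2

theorem smooth_fderiv_apply {g : ℝ × ℝ → ℝ} (hg : ContDiff ℝ (⊤ : ℕ∞) g) (v : ℝ × ℝ) :
    ContDiff ℝ (⊤ : ℕ∞) (fun p => fderiv ℝ g p v) :=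
  (hg.fderiv_right (m := (⊤ : ℕ∞)) (by simp)).clm_apply contDiff_const

theorem smooth_deriv_snd {g : ℝ → ℝ → ℝ}
    (hg : ContDiff ℝ (⊤ : ℕ∞) (fun p : ℝ × ℝ => g p.1 p.2)) :
    ContDiff ℝ (⊤ : ℕ∞) (fun p : ℝ × ℝ => deriv (g p.1) p.2) := by
  have : (fun p : ℝ × ℝ => deriv (g p.1) p.2)
      = fun p => fderiv ℝ (fun p : ℝ × ℝ => g p.1 p.2) p (0, 1) := by
    funext p
    exact (hasDerivAt_snd_of_smooth hg p.1 p.2).deriv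
  rw [this]
  exact smooth_fderiv_apply hg _

theorem smooth_deriv_fst {g : ℝ → ℝ → ℝ}
    (hg : ContDiff ℝ (⊤ : ℕ∞) (fun p : ℝ × ℝ => g p.1 p.2)) :
    ContDiff ℝ (⊤ : ℕ∞) (fun p : ℝ × ℝ => deriv (fun s => g s p.2) p.1) := by
  have : (fun p : ℝ × ℝ => deriv (fun s => g s p.2) p.1)
      = fun p => fderiv ℝ (fun p : ℝ × ℝ => g p.1 p.2) p (1, 0) := by
    funext p
    exact (hasDerivAt_fst_of_smooth hg p.1 p.2).deriv
  rw [this]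
  exact smooth_fderiv_apply hg _

theorem hasDerivAt_clm_curve {A : ℝ × ℝ → (ℝ × ℝ →L[ℝ] ℝ)}
    {A' : ℝ × ℝ →L[ℝ] (ℝ × ℝ →L[ℝ] ℝ)} {c : ℝ → ℝ × ℝ} {c' : ℝ × ℝ} {x : ℝ}
    (hA : HasFDerivAt A A' (c x)) (hc : HasDerivAt c c' x) (v : ℝ × ℝ) :
    HasDerivAt (fun y => A (c y) v) (A' c' v) x := by
  have h := hA.comp_hasDerivAt x hc
  exact ((ContinuousLinearMap.apply ℝ ℝ v).hasFDerivAt).comp_hasDerivAt x h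

/-- Symmetry of mixed partial derivatives. -/
theorem hasDerivAt_mixed {g : ℝ → ℝ → ℝ}
    (hg : ContDiff ℝ (⊤ : ℕ∞) (fun p : ℝ × ℝ => g p.1 p.2)) (t x : ℝ) :
    HasDerivAt (fun y => deriv (fun s => g s y) t) (deriv (fun s => deriv (g s) x) t) x := by
  set G : ℝ × ℝ → ℝ := fun p => g p.1 p.2 with hG
  have hd : DifferentiableAt ℝ (fderiv ℝ G) (t, x) :=
    (hg.fderiv_right (m := (⊤ : ℕ∞)) (by simp)).differentiable (by simp) _
  have hsymm : IsSymmSndFDerivAt ℝ G (t, x) :=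
    hg.contDiffAt.isSymmSndFDerivAt (by
      rw [minSmoothness_of_isRCLikeNormedField]
      exact ENat.LEInfty.out)
  have e1 : (fun y => deriv (fun s => g s y) t) = fun y => fderiv ℝ G (t, y) (1, 0) := by
    funext y
    exact (hasDerivAt_fst_of_smooth hg t y).deriv
  have e2 : (fun s => deriv (g s) x) = fun s => fderiv ℝ G (s, x) (0, 1) := by
    funext s
    exact (hasDerivAt_snd_of_smooth hg s x).deriv
  have h2 : HasDerivAt (fun y : ℝ => (t, y)) ((0 : ℝ), (1 : ℝ)) x :=
    (hasDerivAt_const x t).prodMk (hasDerivAt_id x)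
  have h1 : HasDerivAt (fun y : ℝ => (y, x)) ((1 : ℝ), (0 : ℝ)) t :=
    (hasDerivAt_id t).prodMk (hasDerivAt_const t x)
  have k1 : HasDerivAt (fun y => fderiv ℝ G (t, y) (1, 0))
      (fderiv ℝ (fderiv ℝ G) (t, x) (0, 1) (1, 0)) x := by
    exact hasDerivAt_clm_curve hd.hasFDerivAt h2 ((1 : ℝ), (0 : ℝ))
  have k2 : HasDerivAt (fun s => fderiv ℝ G (s, x) (0, 1))
      (fderiv ℝ (fderiv ℝ G) (t, x) (1, 0) (0, 1)) t := by
    exact hasDerivAt_clm_curve (c := fun y : ℝ => (y, x)) (x := t) hd.hasFDerivAt h1 ((0 : ℝ), (1 : ℝ))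
  rw [e1, e2, k2.deriv, hsymm.eq]
  exact k1

/-- For a smooth solution of mKdV, all of whose space derivatives (and their
time derivatives) decay faster than any polynomial, locally uniformly in time, the second
energy `F[u](t) := ∫ ((1/2)u_{xx}² − (5/2)u²u_x² + (1/4)u⁶)(t,x) dx` is constant in time. -/
theorem second_energy_conservation (u : ℝ → ℝ → ℝ)
    (hsmooth : ContDiff ℝ (⊤ : ℕ∞) (fun p : ℝ × ℝ => u p.1 p.2))
    (hmkdv : ∀ t x : ℝ,
      deriv (fun s => u s x) t
        + deriv (fun y => deriv (deriv (u t)) y + (u t y) ^ 3) x = 0)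
    (hdecay : ∀ n k : ℕ, ∀ T : ℝ, 0 < T → ∃ C : ℝ, ∀ t ∈ Set.Icc (-T) T, ∀ x : ℝ,
      (1 + |x|) ^ k * |iteratedDeriv n (u t) x| ≤ C)
    (hdecay' : ∀ n k : ℕ, ∀ T : ℝ, 0 < T → ∃ C : ℝ, ∀ t ∈ Set.Icc (-T) T, ∀ x : ℝ,
      (1 + |x|) ^ k * |deriv (fun s => iteratedDeriv n (u s) x) t| ≤ C) :
    ∀ t₁ t₂ : ℝ,
      (∫ x : ℝ, ((1 / 2) * (deriv (deriv (u t₁)) x) ^ 2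
          - (5 / 2) * (u t₁ x) ^ 2 * (deriv (u t₁) x) ^ 2 + (1 / 4) * (u t₁ x) ^ 6))
        = ∫ x : ℝ, ((1 / 2) * (deriv (deriv (u t₂)) x) ^ 2
          - (5 / 2) * (u t₂ x) ^ 2 * (deriv (u t₂) x) ^ 2 + (1 / 4) * (u t₂ x) ^ 6) := by
  have hUs : ∀ n : ℕ, ContDiff ℝ (⊤ : ℕ∞) (fun p : ℝ × ℝ => iteratedDeriv n (u p.1) p.2) := by
    intro n
    induction n with
    | zero => simpa using hsmooth
    | succ n ih =>
      simp only [iteratedDeriv_succ]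
      exact smooth_deriv_snd (g := fun t => iteratedDeriv n (u t)) ih
  obtain ⟨U, hU⟩ : ∃ U : ℕ → ℝ → ℝ → ℝ, U = fun n t x => iteratedDeriv n (u t) x := ⟨_, rfl⟩
  obtain ⟨W, hW⟩ : ∃ W : ℕ → ℝ → ℝ → ℝ, W = fun n t x => deriv (fun s => U n s x) t := ⟨_, rfl⟩
  have hUsm : ∀ n, ContDiff ℝ (⊤ : ℕ∞) (fun p : ℝ × ℝ => U n p.1 p.2) := by
    subst hU; exact hUs
  have hUsucc : ∀ n t, deriv (U n t) = U (n + 1) t := by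
    intro n t
    subst hU
    exact iteratedDeriv_succ.symm
  have hUx : ∀ n t x, HasDerivAt (U n t) (U (n + 1) t x) x := by
    intro n t x
    rw [← hUsucc]
    exact (hasDerivAt_snd_of_smooth (hUsm n) t x).differentiableAt.hasDerivAt
  have hUt : ∀ n t x, HasDerivAt (fun s => U n s x) (W n t x) t := by
    intro n t x
    rw [hW]
    exact (hasDerivAt_fst_of_smooth (hUsm n) t x).differentiableAt.hasDerivAt
  have hWx : ∀ n t x, HasDerivAt (W n t) (W (n + 1) t x) x := by
    intro n t x
    have := hasDerivAt_mixed (hUsm n) t x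
    simp only [hUsucc] at this
    rw [hW]
    exact this
  have hUc : ∀ n t, Continuous (U n t) := fun n t =>
    continuous_iff_continuousAt.2 fun x => (hUx n t x).continuousAt
  have hWc : ∀ n t, Continuous (W n t) := fun n t =>
    continuous_iff_continuousAt.2 fun x => (hWx n t x).continuousAt
  have hUg : ∀ n T, 0 < T → GoodDecay T (U n) := by
    intro n T hT
    subst hU
    exact GoodDecay.of_decay (hdecay n 2 T hT)
  have hWg : ∀ n T, 0 < T → GoodDecay T (W n) := by
    intro n T hT
    subst hW hU
    exact GoodDecay.of_decay (hdecay' n 2 T hT)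
  have hu0 : ∀ t, u t = U 0 t := by
    intro t
    subst hU
    simp
  have hpde : ∀ t x, W 0 t x + (U 3 t x + 3 * U 0 t x ^ 2 * U 1 t x) = 0 := by
    intro t x
    have h := hmkdv t x
    simp only [hu0, hUsucc] at h
    have h1 := ((hUx 2 t x).add ((hUx 0 t x).pow 3)).deriv
    have h2 : deriv (fun y => U (0 + 1 + 1) t y + U 0 t y ^ 3) x
      = deriv (U 2 t + U 0 t ^ 3) x := rfl
    rw [h2, h1, (hUt 0 t x).deriv] at h
    norm_num at h
    linarith
  clear hdecay hdecay' hmkdv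
  simp only [hu0, hUsucc]
  -- the energy density, its time derivative, and its flux
  obtain ⟨e, he⟩ : ∃ e : ℝ → ℝ → ℝ, e = fun t x => (1 / 2) * U 2 t x ^ 2
    - (5 / 2) * (U 0 t x ^ 2 * U 1 t x ^ 2) + (1 / 4) * U 0 t x ^ 6 := ⟨_, rfl⟩
  obtain ⟨e', he'⟩ : ∃ e' : ℝ → ℝ → ℝ, e' = fun t x => U 2 t x * W 2 t x
    - 5 * (U 0 t x * U 1 t x ^ 2 * W 0 t x) - 5 * (U 0 t x ^ 2 * U 1 t x * W 1 t x)
    + (3 / 2) * (U 0 t x ^ 5 * W 0 t x) := ⟨_, rfl⟩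
  obtain ⟨P, hP⟩ : ∃ P : ℝ → ℝ → ℝ, P = fun t x => U 2 t x * W 1 t x
    - U 3 t x * W 0 t x - 5 * (U 0 t x ^ 2 * U 1 t x * W 0 t x)
    - ((1 / 2) * U 3 t x ^ 2 + 3 * (U 0 t x ^ 2 * U 1 t x * U 3 t x)
      + U 0 t x ^ 2 * U 2 t x ^ 2 - U 0 t x * U 1 t x ^ 2 * U 2 t x + (1 / 4) * U 1 t x ^ 4
      + (15 / 4) * (U 0 t x ^ 4 * U 1 t x ^ 2) + (3 / 2) * (U 0 t x ^ 5 * U 2 t x)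
      + (9 / 16) * U 0 t x ^ 8) := ⟨_, rfl⟩
  have het : ∀ t x, HasDerivAt (fun s => e s x) (e' t x) t := by
    intro t x
    have h0 := hUt 0 t x
    have h1 := hUt 1 t x
    have h2 := hUt 2 t x
    have := ((((h2.pow 2).const_mul (1 / 2)).sub (((h0.pow 2).mul (h1.pow 2)).const_mul (5 / 2))).add
      ((h0.pow 6).const_mul (1 / 4)))
    rw [he, he']
    refine this.congr_deriv ?_
    simp only [Pi.pow_apply]
    push_cast
    ring
  have hPx : ∀ t x, HasDerivAt (P t) (e' t x) x := by
    intro t x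
    have h0 := hUx 0 t x
    have h1 := hUx 1 t x
    have h2 := hUx 2 t x
    have h3 := hUx 3 t x
    have w0 := hWx 0 t x
    have w1 := hWx 1 t x
    have := (((h2.mul w1).sub (h3.mul w0)).sub ((((h0.pow 2).mul h1).mul w0).const_mul 5)).sub
      ((((((((h3.pow 2).const_mul (1 / 2)).add ((((h0.pow 2).mul h1).mul h3).const_mul 3)).add
        ((h0.pow 2).mul (h2.pow 2))).sub ((h0.mul (h1.pow 2)).mul h2)).add
        ((h1.pow 4).const_mul (1 / 4))).add
        (((h0.pow 4).mul (h1.pow 2)).const_mul (15 / 4))).add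
        (((h0.pow 5).mul h2).const_mul (3 / 2)) |>.add ((h0.pow 8).const_mul (9 / 16)))
    rw [hP, he']
    refine this.congr_deriv ?_
    simp only [Pi.pow_apply, Pi.mul_apply]
    push_cast
    norm_num
    linear_combination (-(U 4 t x + 5 * U 0 t x * U 1 t x ^ 2 + 5 * U 0 t x ^ 2 * U 2 t x
      + 3 / 2 * U 0 t x ^ 5)) * hpde t x
  have heg : ∀ T, 0 < T → GoodDecay T e := by
    intro T hT
    have g := fun n => hUg n T hT
    rw [he]
    exact ((((g 2).pow 1).cmul _).sub ((((g 0).pow 1).mul ((g 1).pow 1)).cmul _)).add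
      (((g 0).pow 5).cmul _)
  have heg' : ∀ T, 0 < T → GoodDecay T e' := by
    intro T hT
    have g := fun n => hUg n T hT
    have w := fun n => hWg n T hT
    rw [he']
    exact ((((g 2).mul (w 2)).sub ((((g 0).mul ((g 1).pow 1)).mul (w 0)).cmul _)).sub
      (((((g 0).pow 1).mul (g 1)).mul (w 1)).cmul _)).add ((((g 0).pow 4).mul (w 0)).cmul _)
  have hPg : ∀ T, 0 < T → GoodDecay T P := by
    intro T hT
    have g := fun n => hUg n T hT
    have w := fun n => hWg n T hT
    rw [hP]
    exact ((((g 2).mul (w 1)).sub ((g 3).mul (w 0))).sub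
      (((((g 0).pow 1).mul (g 1)).mul (w 0)).cmul _)).sub
      (((((((((g 3).pow 1).cmul _).add (((((g 0).pow 1).mul (g 1)).mul (g 3)).cmul _)).add
        (((g 0).pow 1).mul ((g 2).pow 1))).sub (((g 0).mul ((g 1).pow 1)).mul (g 2))).add
        (((g 1).pow 3).cmul _)).add ((((g 0).pow 3).mul ((g 1).pow 1)).cmul _)).add
        ((((g 0).pow 4).mul (g 2)).cmul _) |>.add (((g 0).pow 7).cmul _))
  have hec : ∀ t, Continuous (e t) := by
    intro t
    have h0 := hUc 0 t
    have h1 := hUc 1 t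
    have h2 := hUc 2 t
    rw [he]
    fun_prop
  have hec' : ∀ t, Continuous (e' t) := by
    intro t
    have h0 := hUc 0 t
    have h1 := hUc 1 t
    have h2 := hUc 2 t
    have h3 := hWc 0 t
    have h4 := hWc 1 t
    have h5 := hWc 2 t
    rw [he']
    fun_prop
  have hPc : ∀ t, Continuous (P t) := fun t =>
    continuous_iff_continuousAt.2 fun x => (hPx t x).continuousAt
  have hmain : ∀ t, HasDerivAt (fun s => ∫ x, e s x) 0 t := by
    intro t
    have hT : 0 < |t| + 1 := by positivity
    have hmem : t ∈ Set.Icc (-(|t| + 1)) (|t| + 1) :=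
      ⟨by linarith [neg_abs_le t], by linarith [le_abs_self t]⟩
    have hnhds : Set.Icc (-(|t| + 1)) (|t| + 1) ∈ nhds t :=
      Icc_mem_nhds (by linarith [neg_abs_le t]) (by linarith [le_abs_self t])
    have hz : ∫ x, e' t x = 0 :=
      integral_eq_zero_of_hasDerivAt_of_integrable (hPx t)
        ((heg' _ hT).integrable hmem (hec' t)) ((hPg _ hT).integrable hmem (hPc t))
    obtain ⟨C, hC⟩ := heg' _ hT
    have key := hasDerivAt_integral_of_dominated_loc_of_deriv_le (μ := volume) (F := e) (F' := e')
      (x₀ := t) (bound := fun x => C * (1 + x ^ 2)⁻¹) hnhds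
      (Filter.Eventually.of_forall fun s => (hec s).aestronglyMeasurable)
      ((heg _ hT).integrable hmem (hec t)) (hec' t).aestronglyMeasurable
      (Filter.Eventually.of_forall fun x s hs => by
        have hp : (0 : ℝ) < 1 + x ^ 2 := by positivity
        rw [Real.norm_eq_abs, ← div_eq_mul_inv, le_div_iff₀ hp, mul_comm]
        exact hC s hs x)
      (integrable_inv_one_add_sq.const_mul C)
      (Filter.Eventually.of_forall fun x s _ => het s x)
    rw [← hz]
    exact key.2
  intro t₁ t₂
  have hconst := is_const_of_deriv_eq_zero (fun t => (hmain t).differentiableAt)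
    (fun t => (hmain t).deriv) t₁ t₂
  simp only [he] at hconst
  simpa only [mul_assoc] using hconst
end

section
/- Let u : ℝ × ℝ → ℝ be a smooth solution of mKdV (i.e., ∂_t u + ∂_x(∂_{xx}u + u³) = 0 pointwise) such that for every n, k ∈ ℕ the quantity (1+|x|)^k·|∂_x^n u(t,x)| is bounded on [−T,T] × ℝ for every T > 0, and similarly for ∂_t∂_x^n u. Let φ : ℝ → ℝ be smooth with all derivatives bounded and let m ∈ ℝ. Then for every t, d/dt ∫_ℝ u²(t,x)·φ(x − m·t) dx = ∫_ℝ (−3·(∂_x u)²(t,x) + (3/2)·u⁴(t,x) − m·u²(t,x))·φ'(x − m·t) dx + ∫_ℝ u²(t,x)·φ'''(x − m·t) dx. -/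
open MeasureTheory

/-- Continuous and bounded real functions. -/
def CB (f : ℝ → ℝ) : Prop := Continuous f ∧ ∃ C : ℝ, ∀ x, |f x| ≤ C

theorem CB.mul {f g : ℝ → ℝ} (hf : CB f) (hg : CB g) : CB (fun x => f x * g x) := by
  obtain ⟨hf, C, hC⟩ := hf
  obtain ⟨hg, D, hD⟩ := hg
  refine ⟨hf.mul hg, C * D, fun x => ?_⟩
  rw [abs_mul]
  exact mul_le_mul (hC x) (hD x) (abs_nonneg _) ((abs_nonneg _).trans (hC x))

theorem CB.add {f g : ℝ → ℝ} (hf : CB f) (hg : CB g) : CB (fun x => f x + g x) := by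
  obtain ⟨hf, C, hC⟩ := hf
  obtain ⟨hg, D, hD⟩ := hg
  exact ⟨hf.add hg, C + D, fun x => (abs_add_le _ _).trans (add_le_add (hC x) (hD x))⟩

theorem CB.const (c : ℝ) : CB (fun _ => c) := ⟨continuous_const, |c|, fun _ => le_rfl⟩

theorem integrable_mul_CB {f g : ℝ → ℝ} (hf : Integrable f) (hg : CB g) :
    Integrable (fun x => f x * g x) := by
  obtain ⟨hg, D, hD⟩ := hg
  exact hf.mul_bdd (c := D) hg.aestronglyMeasurable (Filter.Eventually.of_forall hD)

theorem decay_bound {C a x : ℝ} (h : (1 + |x|) ^ 2 * |a| ≤ C) : |a| ≤ C * (1 + x ^ 2)⁻¹ := by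
  rw [← div_eq_mul_inv, le_div_iff₀ (by positivity)]
  have : 1 + x ^ 2 ≤ (1 + |x|) ^ 2 := by nlinarith [sq_abs x, abs_nonneg x]
  nlinarith [abs_nonneg a]

theorem hasDerivAt_iter {f : ℝ → ℝ} (hf : ContDiff ℝ (⊤ : ℕ∞) f) (n : ℕ) (x : ℝ) :
    HasDerivAt (iteratedDeriv n f) (iteratedDeriv (n + 1) f x) x := by
  rw [iteratedDeriv_succ]
  exact ((hf.differentiable_iteratedDeriv n (by exact_mod_cast WithTop.coe_lt_top _)) x).hasDerivAt

/-- virial-type identity for the localized mass. For a smooth, rapidly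
decaying solution `u` of mKdV, a smooth weight `φ` with all derivatives bounded and a
speed `m`, for every `t`:
`d/dt ∫ u²(t,x)·φ(x−mt) dx
  = ∫ (−3u_x² + (3/2)u⁴ − m·u²)(t,x)·φ'(x−mt) dx + ∫ u²(t,x)·φ'''(x−mt) dx`. -/
theorem localized_mass_virial_identity (u : ℝ → ℝ → ℝ)
    (hsmooth : ContDiff ℝ (⊤ : ℕ∞) (fun p : ℝ × ℝ => u p.1 p.2))
    (hmkdv : ∀ t x : ℝ,
      deriv (fun s => u s x) t
        + deriv (fun y => deriv (deriv (u t)) y + (u t y) ^ 3) x = 0)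
    (hdecay : ∀ n k : ℕ, ∀ T : ℝ, 0 < T → ∃ C : ℝ, ∀ t ∈ Set.Icc (-T) T, ∀ x : ℝ,
      (1 + |x|) ^ k * |iteratedDeriv n (u t) x| ≤ C)
    (hdecay' : ∀ n k : ℕ, ∀ T : ℝ, 0 < T → ∃ C : ℝ, ∀ t ∈ Set.Icc (-T) T, ∀ x : ℝ,
      (1 + |x|) ^ k * |deriv (fun s => iteratedDeriv n (u s) x) t| ≤ C)
    (φ : ℝ → ℝ) (hφ : ContDiff ℝ (⊤ : ℕ∞) φ)
    (hφbd : ∀ n : ℕ, ∃ C : ℝ, ∀ x : ℝ, |iteratedDeriv n φ x| ≤ C)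
    (m : ℝ) :
    ∀ t : ℝ, HasDerivAt (fun s => ∫ x : ℝ, (u s x) ^ 2 * φ (x - m * s))
      ((∫ x : ℝ, (-3 * (deriv (u t) x) ^ 2 + (3 / 2) * (u t x) ^ 4 - m * (u t x) ^ 2)
          * deriv φ (x - m * t))
        + ∫ x : ℝ, (u t x) ^ 2 * iteratedDeriv 3 φ (x - m * t)) t := by
  intro t
  have hux : ∀ s, ContDiff ℝ (⊤ : ℕ∞) (u s) := fun s =>
    hsmooth.comp (contDiff_const.prodMk contDiff_id)
  have hut : ∀ x, ContDiff ℝ (⊤ : ℕ∞) (fun s => u s x) := fun x =>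
    hsmooth.comp (contDiff_id.prodMk contDiff_const)
  have hutd : ∀ x s, HasDerivAt (fun s => u s x) (deriv (fun s => u s x) s) s := fun x s =>
    ((hut x).differentiable (by simp) s).hasDerivAt
  have hT : (0 : ℝ) < |t| + 1 := by positivity
  have htT : t ∈ Set.Icc (-(|t| + 1)) (|t| + 1) :=
    ⟨by linarith [neg_abs_le t], by linarith [le_abs_self t]⟩
  -- spatial derivatives
  obtain ⟨a, ha⟩ : ∃ a : ℕ → ℝ → ℝ, a = fun n => iteratedDeriv n (u t) := ⟨_, rfl⟩
  obtain ⟨b, hb⟩ : ∃ b : ℕ → ℝ → ℝ, b = fun n x => iteratedDeriv n φ (x - m * t) := ⟨_, rfl⟩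
  have had : ∀ n x, HasDerivAt (a n) (a (n + 1) x) x := by
    intro n x; subst ha; exact hasDerivAt_iter (hux t) n x
  have hbd : ∀ n x, HasDerivAt (b n) (b (n + 1) x) x := by
    intro n x; subst hb
    exact (hasDerivAt_iter hφ n (x - m * t)).comp_sub_const x (m * t)
  have hac : ∀ n, Continuous (a n) := fun n =>
    continuous_iff_continuousAt.2 fun x => (had n x).continuousAt
  have hbc : ∀ n, Continuous (b n) := fun n =>
    continuous_iff_continuousAt.2 fun x => (hbd n x).continuousAt
  have haCB : ∀ n, CB (a n) := by
    intro n
    obtain ⟨C, hC⟩ := hdecay n 0 _ hT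
    refine ⟨hac n, C, fun x => ?_⟩
    simpa [ha] using hC t htT x
  have hbCB : ∀ n, CB (b n) := by
    intro n
    obtain ⟨C, hC⟩ := hφbd n
    refine ⟨hbc n, C, fun x => ?_⟩
    simpa [hb] using hC (x - m * t)
  have haI : ∀ n, Integrable (a n) := by
    intro n
    obtain ⟨C, hC⟩ := hdecay n 2 _ hT
    refine (integrable_inv_one_add_sq.const_mul C).mono' (hac n).aestronglyMeasurable
      (Filter.Eventually.of_forall fun x => ?_)
    rw [Real.norm_eq_abs, ha]
    exact decay_bound (hC t htT x)
  have ha0 : ∀ x, u t x = a 0 x := by intro x; simp [ha]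
  have ha1 : ∀ x, deriv (u t) x = a 1 x := by intro x; simp [ha]
  have hb0 : ∀ x, φ (x - m * t) = b 0 x := by intro x; simp [hb]
  have hb1 : ∀ x, deriv φ (x - m * t) = b 1 x := by intro x; simp [hb]
  have hb3 : ∀ x, iteratedDeriv 3 φ (x - m * t) = b 3 x := by intro x; simp [hb]
  have hpde : ∀ x, deriv (fun s => u s x) t = -(a 3 x + 3 * a 0 x ^ 2 * a 1 x) := by
    intro x
    have h1 : (fun y => deriv (deriv (u t)) y + (u t y) ^ 3) = fun y => a 2 y + a 0 y ^ 3 := by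
      funext y
      simp [ha, iteratedDeriv_succ]
    have h2 := hmkdv t x
    have h3 : HasDerivAt (fun y => a 2 y + a 0 y ^ 3) _ x := (had 2 x).add ((had 0 x).pow 3)
    rw [h1, h3.deriv] at h2
    norm_num at h2
    linarith
  -- differentiation under the integral sign
  obtain ⟨C2, hC2⟩ := hdecay 0 2 _ hT
  obtain ⟨C0, hC0⟩ := hdecay 0 0 _ hT
  obtain ⟨D0, hD0⟩ := hdecay' 0 0 _ hT
  obtain ⟨E0, hE0⟩ := hφbd 0
  obtain ⟨E1, hE1⟩ := hφbd 1
  simp only [iteratedDeriv_zero, iteratedDeriv_one, pow_zero, one_mul] at hC2 hC0 hD0 hE0 hE1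
  have hball : ∀ s ∈ Metric.ball t 1, s ∈ Set.Icc (-(|t| + 1)) (|t| + 1) := by
    intro s hs
    rw [Metric.mem_ball, Real.dist_eq, abs_lt] at hs
    exact ⟨by linarith [neg_abs_le t], by linarith [le_abs_self t]⟩
  have hCn : 0 ≤ C0 := (abs_nonneg _).trans (hC0 t htT 0)
  have hDn : 0 ≤ D0 := (abs_nonneg _).trans (hD0 t htT 0)
  have hF't : (fun x => u t x * (2 * deriv (fun s => u s x) t * φ (x - m * t)
      - m * u t x * deriv φ (x - m * t)))
      = fun x => a 0 x * (2 * (-1 * (a 3 x + 3 * (a 0 x * a 0 x) * a 1 x)) * b 0 x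
        + (-m) * a 0 x * b 1 x) := by
    funext x
    rw [hpde, ha0, hb0, hb1]; ring
  have hFI : Integrable (fun x => a 0 x * (2 * (-1 * (a 3 x + 3 * (a 0 x * a 0 x) * a 1 x)) * b 0 x
        + (-m) * a 0 x * b 1 x)) :=
    integrable_mul_CB (haI 0)
      ((((CB.const 2).mul ((CB.const (-1)).mul ((haCB 3).add (((CB.const 3).mul
        ((haCB 0).mul (haCB 0))).mul (haCB 1))))).mul (hbCB 0)).add
        (((CB.const (-m)).mul (haCB 0)).mul (hbCB 1)))
  have key2 := (hasDerivAt_integral_of_dominated_loc_of_deriv_le (μ := volume)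
    (F := fun s x => (u s x) ^ 2 * φ (x - m * s))
    (F' := fun s x => u s x * (2 * deriv (fun s => u s x) s * φ (x - m * s)
      - m * u s x * deriv φ (x - m * s)))
    (x₀ := t) (s := Metric.ball t 1) (Metric.ball_mem_nhds t one_pos)
    (bound := fun x => C2 * (1 + x ^ 2)⁻¹ * (2 * D0 * E0 + |m| * C0 * E1))
    (Filter.Eventually.of_forall fun s => Continuous.aestronglyMeasurable
      (((hux s).continuous.pow 2).mul (hφ.continuous.comp (by fun_prop))))
    (by
      have := integrable_mul_CB (haI 0) ((haCB 0).mul (hbCB 0))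
      refine this.congr (Filter.Eventually.of_forall fun x => ?_)
      simp only [ha0, hb0]; ring)
    (by rw [hF't]; exact hFI.aestronglyMeasurable)
    (Filter.Eventually.of_forall fun x s hs => by
      have h1 := decay_bound (hC2 s (hball s hs) x)
      have h2 := hC0 s (hball s hs) x
      have h3 := hD0 s (hball s hs) x
      have h4 := hE0 (x - m * s)
      have h5 := hE1 (x - m * s)
      rw [Real.norm_eq_abs, abs_mul]
      refine mul_le_mul h1 ?_ (abs_nonneg _) ((abs_nonneg _).trans h1)
      refine (abs_sub _ _).trans ?_
      rw [abs_mul, abs_mul, abs_mul, abs_mul, abs_two]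
      gcongr)
    ((integrable_inv_one_add_sq.const_mul C2).mul_const _)
    (Filter.Eventually.of_forall fun x s _ => by
      have h1 : HasDerivAt (fun s : ℝ => x - m * s) (-m) s := by
        simpa using ((hasDerivAt_id s).const_mul m).const_sub x
      have h2 : HasDerivAt φ (deriv φ (x - m * s)) (x - m * s) :=
        (hφ.differentiable (by simp) _).hasDerivAt
      have h3 := ((hutd x s).pow 2).mul (h2.comp s h1)
      refine HasDerivAt.congr_deriv h3 ?_
      simp; ring)).2
  refine key2.congr_deriv ?_
  rw [hF't]
  simp only [ha0, ha1, hb1, hb3]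
  have hI1 : Integrable (fun x => (-3 * a 1 x ^ 2 + 3 / 2 * a 0 x ^ 4 - m * a 0 x ^ 2) * b 1 x) := by
    have h1 := integrable_mul_CB (haI 1) (((CB.const (-3)).mul (haCB 1)).mul (hbCB 1))
    have h2 := integrable_mul_CB (haI 0) ((((CB.const (3/2)).mul
      ((haCB 0).mul ((haCB 0).mul (haCB 0)))).add ((CB.const (-m)).mul (haCB 0))).mul (hbCB 1))
    refine (h1.add h2).congr (Filter.Eventually.of_forall fun x => ?_)
    simp only [Pi.add_apply]; ring
  have hI2 : Integrable (fun x => a 0 x ^ 2 * b 3 x) := by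
    refine (integrable_mul_CB (haI 0) ((haCB 0).mul (hbCB 3))).congr
      (Filter.Eventually.of_forall fun x => ?_)
    simp only; ring
  have hG : Integrable (fun x => -2 * (a 0 x * a 2 x * b 0 x) + a 1 x ^ 2 * b 0 x
      + 2 * (a 0 x * a 1 x * b 1 x) - a 0 x ^ 2 * b 2 x - 3 / 2 * (a 0 x ^ 4 * b 0 x)) := by
    have h1 := integrable_mul_CB (haI 1) ((haCB 1).mul (hbCB 0))
    have h2 := integrable_mul_CB (haI 0) (((CB.const (-2)).mul ((haCB 2).mul (hbCB 0))).add
      (((CB.const 2).mul ((haCB 1).mul (hbCB 1))).add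
      (((CB.const (-1)).mul ((haCB 0).mul (hbCB 2))).add
      ((CB.const (-3/2)).mul (((haCB 0).mul ((haCB 0).mul (haCB 0))).mul (hbCB 0))))))
    refine (h1.add h2).congr (Filter.Eventually.of_forall fun x => ?_)
    simp only [Pi.add_apply]; ring
  have hz := integral_eq_zero_of_hasDerivAt_of_integrable
    (f' := fun x => a 0 x * (2 * (-1 * (a 3 x + 3 * (a 0 x * a 0 x) * a 1 x)) * b 0 x
        + (-m) * a 0 x * b 1 x)
      - ((-3 * a 1 x ^ 2 + 3 / 2 * a 0 x ^ 4 - m * a 0 x ^ 2) * b 1 x + a 0 x ^ 2 * b 3 x))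
    (fun x => by
      have h := ((((((((had 0 x).mul (had 2 x)).mul (hbd 0 x)).const_mul (-2)).add
        (((had 1 x).pow 2).mul (hbd 0 x))).add
        ((((had 0 x).mul (had 1 x)).mul (hbd 1 x)).const_mul 2)).sub
        (((had 0 x).pow 2).mul (hbd 2 x))).sub
        ((((had 0 x).pow 4).mul (hbd 0 x)).const_mul (3 / 2)))
      refine HasDerivAt.congr_deriv h ?_
      simp; ring)
    (hFI.sub (hI1.add hI2)) hG
  have hI3 : Integrable (fun x => (-3 * a 1 x ^ 2 + 3 / 2 * a 0 x ^ 4 - m * a 0 x ^ 2) * b 1 x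
      + a 0 x ^ 2 * b 3 x) := hI1.add hI2
  rw [integral_sub hFI hI3, integral_add hI1 hI2] at hz
  linarith
end

section
/- Let σ > 0, let v : ℝ → ℝ be a Schwartz function, and let φ : ℝ → ℝ be a positive C¹ function, bounded together with its derivative, satisfying |φ'(x)| ≤ (√σ/2)·φ(x) for all x. Then ∫_ℝ (v'')²·φ ≤ (∫_ℝ (v')²·φ · ∫_ℝ (v''')²·φ)^{1/2} + (√σ/2)·(∫_ℝ (v')²·φ · ∫_ℝ (v'')²·φ)^{1/2}. -/
open MeasureTheory

lemma int_aux (f g : SchwartzMap ℝ ℝ) (w : ℝ → ℝ) (hw : Continuous w)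
    (hb : ∃ C : ℝ, ∀ x, |w x| ≤ C) : Integrable (fun x => f x * g x * w x) := by
  obtain ⟨C, hC⟩ := hb
  have h1 : Integrable (fun x => f x * g x) :=
    MemLp.integrable_mul (f.memLp 2) (g.memLp 2)
  exact h1.mul_bdd (c := C) hw.aestronglyMeasurable (Filter.Eventually.of_forall hC)

lemma cs_aux (f g : SchwartzMap ℝ ℝ) (w : ℝ → ℝ) (hw : Continuous w)
    (hb : ∃ C : ℝ, ∀ x, |w x| ≤ C) (hp : ∀ x, 0 < w x) :
    ∫ x, |f x * g x| * w x ≤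
      Real.sqrt ((∫ x, (f x) ^ 2 * w x) * (∫ x, (g x) ^ 2 * w x)) := by
  have hff : Integrable (fun x => (f x) ^ 2 * w x) := by
    simpa only [sq] using int_aux f f w hw hb
  have hgg : Integrable (fun x => (g x) ^ 2 * w x) := by
    simpa only [sq] using int_aux g g w hw hb
  have hfg : Integrable (fun x => |f x * g x| * w x) := by
    have := (int_aux f g w hw hb).abs
    refine this.congr (Filter.Eventually.of_forall fun x => ?_)
    simp only [abs_mul, abs_of_pos (hp x)]
  apply Real.le_sqrt_of_sq_le
  have key : ∀ t : ℝ, 0 ≤ (∫ x, (f x) ^ 2 * w x) * (t * t)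
      + (-2 * ∫ x, |f x * g x| * w x) * t + ∫ x, (g x) ^ 2 * w x := by
    intro t
    have h0 : 0 ≤ ∫ x, (t * |f x| - |g x|) ^ 2 * w x :=
      integral_nonneg fun x => mul_nonneg (sq_nonneg _) (hp x).le
    have h1 : ∫ x, (t * |f x| - |g x|) ^ 2 * w x
        = ∫ x, (((t * t) * ((f x) ^ 2 * w x) + (-2 * t) * (|f x * g x| * w x))
          + (g x) ^ 2 * w x) := by
      congr 1
      ext x
      rw [abs_mul, ← sq_abs (f x), ← sq_abs (g x)]
      ring
    have h2 : Integrable (fun x => (t * t) * ((f x) ^ 2 * w x)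
        + (-2 * t) * (|f x * g x| * w x)) := (hff.const_mul _).add (hfg.const_mul _)
    rw [h1, integral_add h2 hgg,
      integral_add (hff.const_mul _) (hfg.const_mul _), integral_const_mul,
      integral_const_mul] at h0
    linarith
  have := discrim_le_zero key
  unfold discrim at this
  nlinarith

/-- weighted interpolation inequality. For a Schwartz function `v` and a
positive `C¹` weight `φ`, bounded with bounded derivative, satisfying
`|φ'| ≤ (√σ/2)·φ`, we have
`∫(v'')²φ ≤ (∫(v')²φ · ∫(v''')²φ)^{1/2} + (√σ/2)·(∫(v')²φ · ∫(v'')²φ)^{1/2}`. -/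
theorem weighted_interpolation_inequality (σ : ℝ) (hσ : 0 < σ)
    (v : SchwartzMap ℝ ℝ) (φ : ℝ → ℝ)
    (hφpos : ∀ x : ℝ, 0 < φ x) (hφC1 : ContDiff ℝ 1 φ)
    (hφbd : ∃ C : ℝ, ∀ x : ℝ, φ x ≤ C)
    (hφ'bd : ∃ C : ℝ, ∀ x : ℝ, |deriv φ x| ≤ C)
    (hφ' : ∀ x : ℝ, |deriv φ x| ≤ (Real.sqrt σ / 2) * φ x) :
    (∫ x : ℝ, (iteratedDeriv 2 (⇑v) x) ^ 2 * φ x) ≤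
      Real.sqrt ((∫ x : ℝ, (deriv (⇑v) x) ^ 2 * φ x)
          * (∫ x : ℝ, (iteratedDeriv 3 (⇑v) x) ^ 2 * φ x))
        + (Real.sqrt σ / 2) * Real.sqrt ((∫ x : ℝ, (deriv (⇑v) x) ^ 2 * φ x)
          * (∫ x : ℝ, (iteratedDeriv 2 (⇑v) x) ^ 2 * φ x)) := by
  obtain ⟨a, ha⟩ : ∃ a : SchwartzMap ℝ ℝ, ∀ x, a x = deriv v x :=
    ⟨SchwartzMap.derivCLM ℝ ℝ v, fun x => SchwartzMap.derivCLM_apply ℝ v x⟩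
  obtain ⟨b, hb⟩ : ∃ b : SchwartzMap ℝ ℝ, ∀ x, b x = deriv a x :=
    ⟨SchwartzMap.derivCLM ℝ ℝ a, fun x => SchwartzMap.derivCLM_apply ℝ a x⟩
  obtain ⟨c, hc⟩ : ∃ c : SchwartzMap ℝ ℝ, ∀ x, c x = deriv b x :=
    ⟨SchwartzMap.derivCLM ℝ ℝ b, fun x => SchwartzMap.derivCLM_apply ℝ b x⟩
  have ea : deriv (⇑v) = a := (funext ha).symm
  have eb : iteratedDeriv 2 (⇑v) = b := by
    rw [iteratedDeriv_succ, iteratedDeriv_one, ea]; exact (funext hb).symm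
  have ec : iteratedDeriv 3 (⇑v) = c := by
    rw [iteratedDeriv_succ, eb]; exact (funext hc).symm
  rw [ea, eb, ec]
  have hw : Continuous φ := hφC1.continuous
  have hw' : Continuous (deriv φ) := hφC1.continuous_deriv le_rfl
  have hbd : ∃ C : ℝ, ∀ x, |φ x| ≤ C := by
    obtain ⟨C, hC⟩ := hφbd
    exact ⟨C, fun x => by rw [abs_of_pos (hφpos x)]; exact hC x⟩
  have i1 := int_aux b b φ hw hbd
  have i2 := int_aux a c φ hw hbd
  have i3 := int_aux a b (deriv φ) hw' hφ'bd
  have i4 := int_aux a b φ hw hbd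
  have hd : ∀ x, HasDerivAt (fun x => a x * b x * φ x)
      (b x * b x * φ x + a x * c x * φ x + a x * b x * deriv φ x) x := by
    intro x
    have h1 : HasDerivAt a (b x) x := by rw [hb]; exact a.differentiableAt.hasDerivAt
    have h2 : HasDerivAt b (c x) x := by rw [hc]; exact b.differentiableAt.hasDerivAt
    have h3 : HasDerivAt φ (deriv φ x) x :=
      (hφC1.differentiable one_ne_zero x).hasDerivAt
    refine HasDerivAt.congr_deriv ((h1.mul h2).mul h3) ?_
    simp only [Pi.mul_apply]
    ring
  have h0 := integral_eq_zero_of_hasDerivAt_of_integrable hd ((i1.add i2).add i3) i4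
  have i12 : Integrable (fun x => b x * b x * φ x + a x * c x * φ x) := i1.add i2
  rw [integral_add i12 i3, integral_add i1 i2] at h0
  have c1 := cs_aux a c φ hw hbd hφpos
  have c2 := cs_aux a b φ hw hbd hφpos
  have e1 : -(∫ x, a x * c x * φ x) ≤ ∫ x, |a x * c x| * φ x := by
    refine (neg_le_abs _).trans (abs_integral_le_integral_abs.trans_eq ?_)
    congr 1
    ext x
    rw [abs_mul, abs_of_pos (hφpos x)]
  have e2 : -(∫ x, a x * b x * deriv φ x) ≤ (Real.sqrt σ / 2) * ∫ x, |a x * b x| * φ x := by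
    refine (neg_le_abs _).trans (abs_integral_le_integral_abs.trans ?_)
    rw [← integral_const_mul]
    refine integral_mono i3.abs ?_ fun x => ?_
    · refine (i4.abs.congr (Filter.Eventually.of_forall fun x => ?_)).const_mul _
      simp only [abs_mul, abs_of_pos (hφpos x)]
    · simp only [abs_mul (a x * b x) (deriv φ x)]
      calc _ ≤ |a x * b x| * (Real.sqrt σ / 2 * φ x) :=
            mul_le_mul_of_nonneg_left (hφ' x) (abs_nonneg _)
        _ = _ := by ring
  have e3 := mul_le_mul_of_nonneg_left c2 (show 0 ≤ Real.sqrt σ / 2 by positivity)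
  have e4 : ∫ x, (b x) ^ 2 * φ x = ∫ x, b x * b x * φ x := by simp only [sq]
  linarith
end
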